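/- There do not exist Borel maps φ : ([ω]^ω)^ℕ → [ω]^ω and ψ : 2^ℕ → 2^ℕ such that for every sequence ⟨A_n⟩_{n∈ℕ} of infinite subsets of ℕ and every c ∈ 2^ℕ: if c splits φ(⟨A_n⟩), then ψ(c) splits A_n for every n. (I.e., there is no Borel Tukey morphism from the splitting number 𝔰 to the σ-splitting number 𝔰_σ.) -/

import Mathlib

/-- The subset of ℕ coded by an element of Cantor space. -/
def bset (x : ℕ → Bool) : Set ℕ := {n | x n = true}

/-- `[ω]^ω`, regarded as a subspace of Cantor space via characteristic functions. -/
abbrev InfC := {x : ℕ → Bool // (bset x).Infinite}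

/-- `c ∈ 2^ℕ` splits the infinite set `A ⊆ ℕ`: both `{k ∈ A | c k = false}`
and `{k ∈ A | c k = true}` are infinite. -/
def Splits (c : ℕ → Bool) (A : Set ℕ) : Prop :=
  {k ∈ A | c k = false}.Infinite ∧ {k ∈ A | c k = true}.Infinite

open Filter Topology

/-- The points agreeing with `x` below `m`. -/
def cyl (x : ℕ → Bool) (m : ℕ) : Set (ℕ → Bool) := {y | ∀ i < m, y i = x i}

theorem mem_cyl {x y : ℕ → Bool} {m : ℕ} : y ∈ cyl x m ↔ ∀ i < m, y i = x i := Iff.rfl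

theorem cyl_eq (x : ℕ → Bool) (m : ℕ) :
    cyl x m = PiNat.cylinder (E := fun _ => Bool) x m := rfl

theorem isOpen_cyl (x : ℕ → Bool) (m : ℕ) : IsOpen (cyl x m) := by
  rw [cyl_eq]; exact PiNat.isOpen_cylinder _ x m

theorem exists_cyl_subset {O : Set (ℕ → Bool)} (hO : IsOpen O) {x : ℕ → Bool} (hx : x ∈ O) :
    ∃ n, cyl x n ⊆ O := by
  obtain ⟨v, ⟨y, n, rfl⟩, hxv, hv⟩ :=
    (PiNat.isTopologicalBasis_cylinders (fun _ => Bool)).exists_subset_of_mem_open hx hO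
  refine ⟨n, ?_⟩
  rw [cyl_eq, PiNat.mem_cylinder_iff_eq.1 hxv]
  exact hv

/-- An infinite set is split by some point. -/
theorem exists_split (Y : Set ℕ) (hY : Y.Infinite) :
    ∃ d : ℕ → Bool, {k ∈ Y | d k = false}.Infinite ∧ {k ∈ Y | d k = true}.Infinite := by
  classical
  have hY' : (Set.ofPred (fun k => k ∈ Y)).Infinite := hY
  refine ⟨fun i => decide (Nat.count (fun k => k ∈ Y) i % 2 = 0), ?_, ?_⟩
  · refine Set.infinite_of_injective_forall_mem
      (f := fun j => Nat.nth (fun k => k ∈ Y) (2 * j + 1)) ?_ ?_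
    · intro a b hab
      have := Nat.nth_injective hY' hab
      omega
    · intro j
      refine ⟨Nat.nth_mem_of_infinite hY' _, ?_⟩
      have := Nat.count_nth_of_infinite hY' (2 * j + 1)
      simp only [this, decide_eq_false_iff_not]
      omega
  · refine Set.infinite_of_injective_forall_mem
      (f := fun j => Nat.nth (fun k => k ∈ Y) (2 * j)) ?_ ?_
    · intro a b hab
      have := Nat.nth_injective hY' hab
      omega
    · intro j
      refine ⟨Nat.nth_mem_of_infinite hY' _, ?_⟩
      have := Nat.count_nth_of_infinite hY' (2 * j)
      simp only [this, decide_eq_true_eq]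
      omega

/-- One step of the construction. -/
theorem step {O : Set (ℕ → Bool)} (hO : IsOpen O) {W D : ℕ → Set (ℕ → Bool)}
    (hW : ∀ k, IsOpen (W k)) (hD : ∀ k, IsOpen (D k)) (hDd : ∀ k, Dense (D k))
    (H : ∀ V : Set (ℕ → Bool), IsOpen V → V.Nonempty → V ⊆ O →
      ∀ᶠ k in (hyperfilter ℕ : Filter ℕ), (W k ∩ V).Nonempty) (m i K : ℕ) :
    ∃ (k n : ℕ) (t : (ℕ → Bool) → (ℕ → Bool)), K < k ∧ m < n ∧
      (∀ x, ∀ y ∈ cyl x m, t y = t x) ∧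
      (∀ x, t x ∈ cyl x m) ∧
      ∀ x ∈ O, cyl (t x) n ⊆ W k ∩ D i := by
  classical
  let ext : (Fin m → Bool) → (ℕ → Bool) := fun s j => if h : j < m then s ⟨j, h⟩ else false
  have hext : ∀ x : ℕ → Bool, cyl (ext fun i => x i) m = cyl x m := by
    intro x
    ext y
    simp only [mem_cyl]
    refine forall₂_congr fun j hj => ?_
    simp [ext, hj]
  have h1 : ∀ᶠ k in (hyperfilter ℕ : Filter ℕ), ∀ s : Fin m → Bool,
      (cyl (ext s) m ∩ O).Nonempty → (W k ∩ (cyl (ext s) m ∩ O)).Nonempty := by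
    rw [eventually_all]
    intro s
    by_cases hs : (cyl (ext s) m ∩ O).Nonempty
    · filter_upwards [H _ ((isOpen_cyl _ _).inter hO) hs Set.inter_subset_right] with k hk _
      exact hk
    · exact Eventually.of_forall fun k hk => absurd hk hs
  have h2 : ∀ᶠ k in (hyperfilter ℕ : Filter ℕ), K < k :=
    (eventually_gt_atTop K).filter_mono Nat.hyperfilter_le_atTop
  obtain ⟨k, hk, hKk⟩ := (h1.and h2).exists
  have h3 : ∀ s : Fin m → Bool, ∃ (z : ℕ → Bool) (n : ℕ), z ∈ cyl (ext s) m ∧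
      ((cyl (ext s) m ∩ O).Nonempty → cyl z n ⊆ W k ∩ D i) := by
    intro s
    by_cases hs : (cyl (ext s) m ∩ O).Nonempty
    · have ho : IsOpen (W k ∩ (cyl (ext s) m ∩ O)) :=
        (hW k).inter ((isOpen_cyl _ _).inter hO)
      obtain ⟨z, hz, hzD⟩ := (hDd i).inter_open_nonempty _ ho (hk s hs)
      obtain ⟨n, hn⟩ := exists_cyl_subset ((hW k).inter (hD i)) ⟨hz.1, hzD⟩
      exact ⟨z, n, hz.2.1, fun _ => hn⟩
    · exact ⟨ext s, 0, fun _ _ => rfl, fun h => absurd h hs⟩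
  choose z n hz hn using h3
  refine ⟨k, (Finset.univ.sup n) + (m + 1), fun x => z fun i => x i, hKk, by omega, ?_, ?_, ?_⟩
  · intro x y hy
    have : (fun i : Fin m => y i) = fun i : Fin m => x i := by
      funext i
      exact hy i i.2
    simp only [this]
  · intro x
    have := hz fun i => x i
    rwa [hext] at this
  · intro x hx
    have h4 := hn (fun i => x i) (by
      rw [hext]; exact ⟨x, fun _ _ => rfl, hx⟩)
    refine Set.Subset.trans ?_ h4
    intro y hy j hj
    refine hy j ?_
    have : n (fun i : Fin m => x i) ≤ Finset.univ.sup n := Finset.le_sup (Finset.mem_univ _)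
    omega

/-- The category-theoretic dichotomy. -/
theorem dichotomy (ψ : (ℕ → Bool) → (ℕ → Bool)) (hψ : Measurable ψ) :
    ∃ (O : Set (ℕ → Bool)) (W D : ℕ → Set (ℕ → Bool)) (b : Bool),
      IsOpen O ∧ O.Nonempty ∧ (∀ k, IsOpen (W k)) ∧ (∀ k, IsOpen (D k)) ∧ (∀ k, Dense (D k)) ∧
      (∀ c, (∀ i, c ∈ D i) → ∀ k, c ∈ W k → ψ c k = b) ∧
      ∀ V : Set (ℕ → Bool), IsOpen V → V.Nonempty → V ⊆ O →
        ∀ᶠ k in (hyperfilter ℕ : Filter ℕ), (W k ∩ V).Nonempty := by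
  have h0 : ∀ (b : Bool) (k : ℕ), ∃ u : Set (ℕ → Bool), IsOpen u ∧
      {c | ψ c k = b} =ᵇ u := by
    intro b k
    refine MeasurableSet.residualEq_isOpen ?_
    exact ((measurable_pi_apply k).comp hψ) (measurableSet_singleton b)
  choose U hU hUe using h0
  have h1 : ∀ᶠ c in residual (ℕ → Bool), ∀ b k, (ψ c k = b ↔ c ∈ U b k) := by
    rw [eventually_countable_forall]
    intro b
    rw [eventually_countable_forall]
    intro k
    exact eventuallyEq_set.1 (hUe b k)
  obtain ⟨G, hG, hGd, hGdense⟩ := mem_residual.1 h1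
  obtain ⟨D, hDo, rfl⟩ := isGδ_iff_eq_iInter_nat.1 hGd
  have hDd : ∀ k, Dense (D k) := fun k => hGdense.mono (Set.iInter_subset _ _)
  have hkey : ∀ b c, (∀ i, c ∈ D i) → ∀ k, c ∈ U b k → ψ c k = b := by
    intro b c hc k hk
    exact (hG (Set.mem_iInter.2 hc) b k).2 hk
  by_cases hc : ∀ V : Set (ℕ → Bool), IsOpen V → V.Nonempty → V ⊆ Set.univ →
        ∀ᶠ k in (hyperfilter ℕ : Filter ℕ), (U false k ∩ V).Nonempty
  · exact ⟨Set.univ, U false, D, false, isOpen_univ, Set.univ_nonempty, hU false, hDo, hDd,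
      hkey false, hc⟩
  · push Not at hc
    obtain ⟨V, hVo, hVn, -, hV⟩ := hc
    refine ⟨V, U true, D, true, hVo, hVn, hU true, hDo, hDd, hkey true, ?_⟩
    intro V' hV'o hV'n hV'V
    have hV2 := hV
    filter_upwards [hV2] with k hk
    obtain ⟨c, hcV, hcG⟩ := hGdense.inter_open_nonempty V' hV'o hV'n
    have hc' := hG hcG
    have hcf : c ∉ U false k := by
      intro h
      have : c ∈ U false k ∩ V := ⟨h, hV'V hcV⟩
      rw [hk] at this
      exact this
    refine ⟨c, ?_, hcV⟩
    rw [← hc' true k]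
    rw [← hc' false k] at hcf
    simpa using hcf

/-- The main construction: there are two infinite sets of colors handled by ψ such that every
infinite set is split by a `c` with `ψ c` constant on one of them. -/
theorem main_construction (ψ : (ℕ → Bool) → (ℕ → Bool)) (hψ : Measurable ψ) :
    ∃ (kk : ℕ → ℕ) (b : Bool), StrictMono kk ∧ ∀ X : Set ℕ, X.Infinite →
      ∃ (c : ℕ → Bool) (p : ℕ), p < 2 ∧ Splits c X ∧ ∀ j, j % 2 = p → ψ c (kk j) = b := by
  obtain ⟨O, W, D, b, hO, ⟨x0, hx0⟩, hW, hD, hDd, hkey, H⟩ := dichotomy ψ hψ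
  have hstep := step hO hW hD hDd H
  choose k n t hk hn ht1 ht2 ht3 using hstep
  obtain ⟨n0, hn0⟩ := exists_cyl_subset hO hx0
  let st : ℕ → ℕ × ℕ := fun j => Nat.rec (n0, 0)
    (fun j p => (n p.1 (j / 2) p.2, k p.1 (j / 2) p.2)) j
  let m : ℕ → ℕ := fun j => (st j).1
  let kk : ℕ → ℕ := fun j => (st (j + 1)).2
  let tt : ℕ → (ℕ → Bool) → (ℕ → Bool) := fun j => t (st j).1 (j / 2) (st j).2
  have hm : StrictMono m := strictMono_nat_of_lt_succ fun j => hn (st j).1 (j / 2) (st j).2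
  have hkk : StrictMono kk := strictMono_nat_of_lt_succ fun j =>
    hk (st (j + 1)).1 ((j + 1) / 2) (st (j + 1)).2
  have hm0 : m 0 = n0 := rfl
  have htt1 : ∀ j x, ∀ y ∈ cyl x (m j), tt j y = tt j x := fun j => ht1 _ _ _
  have htt2 : ∀ j x, tt j x ∈ cyl x (m j) := fun j => ht2 _ _ _
  have htt3 : ∀ j, ∀ x ∈ O, cyl (tt j x) (m (j + 1)) ⊆ W (kk j) ∩ D (j / 2) :=
    fun j => ht3 _ _ _
  clear_value m kk tt
  refine ⟨kk, b, hkk, ?_⟩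
  intro X hX
  let Y : ℕ → Set ℕ := fun p => {x ∈ X | ∃ j, j % 2 ≠ p ∧ m j ≤ x ∧ x < m (j + 1)}
  have hcover : X ⊆ Y 0 ∪ Y 1 ∪ Set.Iio (m 0) := by
    intro x hx
    by_cases hxm : x < m 0
    · exact Or.inr hxm
    · left
      have hex : ∃ j, x < m (j + 1) := ⟨x, lt_of_lt_of_le (Nat.lt_succ_self x) (hm.le_apply)⟩
      classical
      have hj1 := Nat.find_spec hex
      have hj2 : m (Nat.find hex) ≤ x := by
        by_contra hcon
        push Not at hcon
        rcases hq : Nat.find hex with _ | q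
        · rw [hq] at hcon; exact hxm hcon
        · rw [hq] at hcon
          exact Nat.find_min hex (m := q) (by omega) hcon
      rcases Nat.mod_two_eq_zero_or_one (Nat.find hex) with h | h
      · exact Or.inr ⟨hx, _, by omega, hj2, hj1⟩
      · exact Or.inl ⟨hx, _, by omega, hj2, hj1⟩
  have hYinf : ∃ p < 2, (Y p).Infinite := by
    by_contra hcon
    push Not at hcon
    have f0 := hcon 0 (by omega)
    have f1 := hcon 1 (by omega)
    exact hX (((f0.union f1).union (Set.finite_Iio _)).subset hcover)
  obtain ⟨p, hp, hY⟩ := hYinf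
  obtain ⟨d, hd0, hd1⟩ := exists_split _ hY
  let cc : ℕ → (ℕ → Bool) := fun j => Nat.rec x0
    (fun j c => if j % 2 = p then tt j c else fun i => if i < m j then c i else d i) j
  have hcc1 : ∀ j, j % 2 = p → cc (j + 1) = tt j (cc j) := by
    intro j hj
    change (if j % 2 = p then tt j (cc j) else _) = _
    rw [if_pos hj]
  have hcc2 : ∀ j, j % 2 ≠ p → cc (j + 1) = fun i => if i < m j then cc j i else d i := by
    intro j hj
    change (if j % 2 = p then tt j (cc j) else _) = _
    rw [if_neg hj]
  have hcc0 : cc 0 = x0 := rfl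
  clear_value cc
  have hagree : ∀ j, cc (j + 1) ∈ cyl (cc j) (m j) := by
    intro j
    by_cases hj : j % 2 = p
    · rw [hcc1 j hj]; exact htt2 j _
    · rw [hcc2 j hj]; intro i hi; simp [hi]
  have hagree2 : ∀ j l, j ≤ l → cc l ∈ cyl (cc j) (m j) := by
    intro j l hjl
    induction l, hjl using Nat.le_induction with
    | base => exact fun _ _ => rfl
    | succ l hl ih =>
      intro i hi
      rw [hagree l i (lt_of_lt_of_le hi (hm.monotone hl)), ih i hi]
  let c : ℕ → Bool := fun i => cc (i + 1) i
  have hc : ∀ j, c ∈ cyl (cc j) (m j) := by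
    intro j i hi
    change cc (i + 1) i = cc j i
    rcases le_total j (i + 1) with h | h
    · exact hagree2 _ _ h i hi
    · exact (hagree2 _ _ h i (lt_of_lt_of_le (Nat.lt_succ_self i) hm.le_apply)).symm
  have hcO : c ∈ O := by
    apply hn0
    have := hc 0
    rwa [hcc0, hm0] at this
  have hcW : ∀ j, j % 2 = p → c ∈ W (kk j) ∩ D (j / 2) := by
    intro j hj
    apply htt3 j c hcO
    rw [htt1 j _ c (hc j), ← hcc1 j hj]
    exact hc (j + 1)
  have hcd : ∀ x ∈ Y p, c x = d x := by
    rintro x ⟨-, j, hj, h1, h2⟩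
    rw [hc (j + 1) x h2, hcc2 j hj]
    simp [not_lt.2 h1]
  refine ⟨c, p, hp, ⟨?_, ?_⟩, ?_⟩
  · refine hd0.mono ?_
    rintro x ⟨hx, hdx⟩
    exact ⟨hx.1, by rw [hcd x hx, hdx]⟩
  · refine hd1.mono ?_
    rintro x ⟨hx, hdx⟩
    exact ⟨hx.1, by rw [hcd x hx, hdx]⟩
  · intro j hj
    refine hkey c ?_ _ (hcW j hj).1
    intro i
    have := (hcW (2 * i + p) (by omega)).2
    rwa [show (2 * i + p) / 2 = i by omega] at this

/-- There are no Borel maps `φ : ([ω]^ω)^ℕ → [ω]^ω` and `ψ : 2^ℕ → 2^ℕ` such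
that whenever `c` splits `φ(⟨A_n⟩)`, `ψ(c)` splits every `A_n`.
(No Borel Tukey morphism from 𝔰 to 𝔰_σ.) -/
theorem stmt13 :
    ¬ ∃ (φ : (ℕ → InfC) → InfC) (ψ : (ℕ → Bool) → (ℕ → Bool)),
      Measurable φ ∧ Measurable ψ ∧
      ∀ (A : ℕ → InfC) (c : ℕ → Bool),
        Splits c (bset (φ A).1) → ∀ n : ℕ, Splits (ψ c) (bset (A n).1) := by
  classical
  rintro ⟨φ, ψ, -, hψ, h⟩
  obtain ⟨kk, b, hkk, hmain⟩ := main_construction ψ hψ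
  have hA : ∀ p : ℕ, ∃ A : InfC, p < 2 → ∀ x ∈ bset A.1, ∃ j, j % 2 = p ∧ x = kk j := by
    intro p
    by_cases hp : p < 2
    · refine ⟨⟨fun x => decide (∃ j, j % 2 = p ∧ x = kk j), ?_⟩, ?_⟩
      · refine Set.infinite_of_injective_forall_mem (f := fun i => kk (2 * i + p)) ?_ ?_
        · intro i j hij
          have := hkk.injective hij
          omega
        · intro i
          change decide _ = true
          rw [decide_eq_true_eq]
          exact ⟨2 * i + p, by omega, rfl⟩
      · intro _ x hx
        exact of_decide_eq_true hx
    · refine ⟨⟨fun _ => true, ?_⟩, fun h => absurd h hp⟩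
      exact Set.infinite_of_injective_forall_mem (f := fun i : ℕ => i)
        (fun _ _ h => h) fun _ => rfl
  choose A hA using hA
  obtain ⟨c, p, hp, hs, hc⟩ := hmain (bset (φ A).1) (φ A).2
  obtain ⟨s0, s1⟩ := h A c hs p
  obtain ⟨x, hx, hx0⟩ := s0.nonempty
  obtain ⟨y, hy, hy1⟩ := s1.nonempty
  obtain ⟨i, hi, rfl⟩ := hA p hp x hx
  obtain ⟨j, hj, rfl⟩ := hA p hp y hy
  rw [hc i hi] at hx0
  rw [hc j hj, hx0] at hy1
  exact absurd hy1 (by decide)
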